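/- arXiv:2212.14654 — 11 statements merged into one kernel-verified Lean document; each statement's English description precedes it below -/
import Mathlib

section
/- For every β, γ ∈ ℝ, the family (fun m : ℤ => Complex.I ^ m * J_m(β) * Complex.exp (Complex.I * m * γ)) indexed by m ∈ ℤ has sum Complex.exp (Complex.I * β * Real.cos γ); that is, the Jacobi–Anger expansion e^{iβ cos γ} = Σ_{m∈ℤ} i^m J_m(β) e^{imγ} holds with the series summable. -/
open Real MeasureTheory

/-- Bessel function of the first kind of integer order `m`, defined by Bessel's integral
`J_m(x) = (1/π) ∫_0^π cos(x sin θ − m θ) dθ`. -/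
noncomputable def besselJ (m : ℤ) (x : ℝ) : ℝ :=
  (1 / π) * ∫ θ in (0:ℝ)..π, Real.cos (x * Real.sin θ - m * θ)

/-- A function with matching endpoint values and two derivatives, the first also with matching
endpoint values and the second continuous, has summable Fourier coefficients. -/
theorem summable_fourierCoeffOn_of_hasDerivAt {a b : ℝ} (hab : a < b) {f f' f'' : ℝ → ℂ}
    (hf : ∀ x, HasDerivAt f (f' x) x) (hf' : ∀ x, HasDerivAt f' (f'' x) x)
    (hf'' : Continuous f'') (hfab : f a = f b) (hfab' : f' a = f' b) :
    Summable (fourierCoeffOn hab f) := by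
  obtain ⟨C, hC⟩ := isCompact_uIcc.exists_bound_of_continuousOn (s := Set.uIcc a b)
    hf''.continuousOn
  have hba : 0 < b - a := sub_pos.2 hab
  have hbound (n : ℤ) : ‖fourierCoeffOn hab f'' n‖ ≤ C := by
    rw [fourierCoeffOn_eq_integral, norm_smul]
    have h : ‖∫ x in a..b, fourier (-n) (x : AddCircle (b - a)) • f'' x‖ ≤ C * |b - a| := by
      refine intervalIntegral.norm_integral_le_of_norm_le_const fun x hx => ?_
      rw [norm_smul, fourier_apply, Circle.norm_coe, one_mul]
      exact hC x (Set.uIoc_subset_uIcc hx)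
    rw [abs_of_pos hba] at h
    rw [Real.norm_of_nonneg (by positivity), one_div, inv_mul_le_iff₀ hba]
    linarith
  have hcont : Continuous f' := continuous_iff_continuousAt.2 fun x => (hf' x).continuousAt
  refine Summable.of_norm_bounded_eventually
    (g := fun n : ℤ => ((b - a) / (2 * π)) ^ 2 * C * (1 / (n : ℝ) ^ 2))
    ((Real.summable_one_div_int_pow.2 one_lt_two).mul_left _) ?_
  filter_upwards [(Set.finite_singleton (0 : ℤ)).compl_mem_cofinite] with n hn
  have hn : n ≠ 0 := hn
  rw [fourierCoeffOn_of_hasDerivAt hab hn (fun x _ => hf x) (hcont.intervalIntegrable _ _),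
    fourierCoeffOn_of_hasDerivAt hab hn (fun x _ => hf' x) (hf''.intervalIntegrable _ _),
    hfab, hfab']
  calc _ = ‖(((b - a) / (2 * π) : ℝ) : ℂ) ^ 2 * fourierCoeffOn hab f'' n
        * (1 / (Complex.I * n) ^ 2)‖ := by
        congr 1
        have : (n : ℂ) ≠ 0 := by exact_mod_cast hn
        have : (π : ℂ) ≠ 0 := by exact_mod_cast pi_ne_zero
        push_cast
        field_simp
        ring
    _ = ((b - a) / (2 * π)) ^ 2 * ‖fourierCoeffOn hab f'' n‖ * (1 / (n : ℝ) ^ 2) := by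
        rw [norm_mul, norm_mul, norm_pow, Complex.norm_real, Real.norm_of_nonneg (by positivity)]
        simp
    _ ≤ _ := by gcongr; exact hbound n

/-- Pointwise convergence of the Fourier series of a periodic function with continuous second
derivative. -/
theorem Function.Periodic.hasSum_fourierCoeffOn {T : ℝ} [hT : Fact (0 < T)] {f f' f'' : ℝ → ℂ}
    (hper : Function.Periodic f T) (hper' : Function.Periodic f' T)
    (hf : ∀ x, HasDerivAt f (f' x) x) (hf' : ∀ x, HasDerivAt f' (f'' x) x)
    (hf'' : Continuous f'') (a t : ℝ) :
    HasSum (fun n : ℤ => fourierCoeffOn (lt_add_of_pos_right a hT.out) f n *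
      fourier n (t : AddCircle T)) (f t) := by
  have hcont : Continuous f := continuous_iff_continuousAt.2 fun x => (hf x).continuousAt
  let F : C(AddCircle T, ℂ) := ⟨hper.lift, continuous_coinduced_dom.2 hcont⟩
  have hF : fourierCoeff F = fourierCoeffOn (lt_add_of_pos_right a hT.out) f := by
    ext n
    rw [fourierCoeffOn_eq_integral, fourierCoeff_eq_intervalIntegral _ _ a, add_sub_cancel_left]
    rfl
  have hsum : Summable (fourierCoeff F) := by
    rw [hF]
    exact summable_fourierCoeffOn_of_hasDerivAt _ hf hf' hf'' (hper a).symm (hper' a).symm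
  have h := has_pointwise_sum_fourier_series_of_summable hsum (t : AddCircle T)
  rw [hF] at h
  exact h

/-- The Bessel functions of integer order are the Fourier coefficients of `e^{ix sin θ}`. -/
theorem fourierCoeffOn_exp_sin_eq_besselJ (x : ℝ) (m : ℤ) (h : -π < -π + 2 * π) :
    fourierCoeffOn h (fun θ : ℝ => Complex.exp (Complex.I * x * Real.sin θ)) m = besselJ m x := by
  let G : ℝ → ℂ := fun θ => Complex.exp ((x * Real.sin θ - m * θ : ℝ) * Complex.I)
  have hG : Continuous G := by fun_prop
  have hsplit : ∫ θ in (-π)..π, G θ =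
      2 * ∫ θ in (0 : ℝ)..π, ((Real.cos (x * Real.sin θ - m * θ) : ℝ) : ℂ) := by
    rw [← intervalIntegral.integral_add_adjacent_intervals (hG.intervalIntegrable (-π) 0)
      (hG.intervalIntegrable 0 π)]
    have hneg : ∫ θ in (-π)..0, G θ = ∫ θ in (0 : ℝ)..π, G (-θ) := by
      rw [intervalIntegral.integral_comp_neg, neg_zero]
    rw [hneg, ← intervalIntegral.integral_add
      (Continuous.intervalIntegrable (u := fun θ => G (-θ)) (by fun_prop) 0 π)
      (hG.intervalIntegrable 0 π),
      ← intervalIntegral.integral_const_mul]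
    refine intervalIntegral.integral_congr fun θ _ => ?_
    simp only [G]
    rw [Complex.ofReal_cos, Complex.two_cos, add_comm]
    congr 2
    rw [Real.sin_neg]
    push_cast
    ring
  rw [fourierCoeffOn_eq_integral, show -π + 2 * π = π by ring, besselJ, Complex.ofReal_mul,
    ← intervalIntegral.integral_ofReal]
  have hint : ∫ θ in (-π)..π, fourier (-m) (θ : AddCircle (π - -π)) •
      Complex.exp (Complex.I * x * Real.sin θ) = ∫ θ in (-π)..π, G θ := by
    refine intervalIntegral.integral_congr fun θ _ => ?_
    simp only [G]
    rw [fourier_coe_apply, smul_eq_mul, ← Complex.exp_add]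
    congr 1
    have : (π : ℂ) ≠ 0 := by exact_mod_cast pi_ne_zero
    push_cast
    rw [show (π : ℂ) - -π = 2 * π by ring]
    field_simp
    ring
  rw [hint, hsplit, Complex.real_smul]
  have : (π : ℂ) ≠ 0 := by exact_mod_cast pi_ne_zero
  push_cast
  rw [show (π : ℂ) - -π = 2 * π by ring]
  field_simp

/-- The generating series of the Bessel functions on the unit circle. -/
theorem hasSum_besselJ_mul_exp (x t : ℝ) :
    HasSum (fun m : ℤ => (besselJ m x : ℂ) * Complex.exp (Complex.I * m * t))
      (Complex.exp (Complex.I * x * Real.sin t)) := by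
  have : Fact (0 < 2 * π) := ⟨two_pi_pos⟩
  let f : ℝ → ℂ := fun θ => Complex.exp (Complex.I * x * Real.sin θ)
  have hf (θ : ℝ) : HasDerivAt f (f θ * (Complex.I * x * Real.cos θ)) θ :=
    ((Real.hasDerivAt_sin θ).ofReal_comp.const_mul (Complex.I * x)).cexp
  have hf' (θ : ℝ) : HasDerivAt (fun θ => f θ * (Complex.I * x * Real.cos θ))
      (f θ * (Complex.I * x * Real.cos θ) * (Complex.I * x * Real.cos θ) +
        f θ * (Complex.I * x * (-Real.sin θ : ℝ))) θ :=
    (hf θ).mul ((Real.hasDerivAt_cos θ).ofReal_comp.const_mul (Complex.I * x))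
  have hper : Function.Periodic f (2 * π) := fun θ => by simp only [f, Real.sin_add_two_pi]
  have hper' : Function.Periodic (fun θ => f θ * (Complex.I * x * Real.cos θ)) (2 * π) :=
    fun θ => by simp only [hper θ, Real.cos_add_two_pi]
  have h := hper.hasSum_fourierCoeffOn hper' hf hf' (by fun_prop) (-π) t
  refine h.congr_fun fun m => ?_
  rw [fourierCoeffOn_exp_sin_eq_besselJ, fourier_coe_apply]
  congr 2
  have : (π : ℂ) ≠ 0 := by exact_mod_cast pi_ne_zero
  push_cast
  field_simp

/-- Jacobi–Anger expansion: `e^{iβ cos γ} = Σ_{m ∈ ℤ} i^m J_m(β) e^{imγ}`,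
with the series summable (as a `HasSum` over `ℤ`). -/
theorem jacobi_anger (β γ : ℝ) :
    HasSum (fun m : ℤ =>
        Complex.I ^ m * (besselJ m β : ℂ) * Complex.exp (Complex.I * m * γ))
      (Complex.exp (Complex.I * β * Real.cos γ)) := by
  have h := hasSum_besselJ_mul_exp β (γ + π / 2)
  rw [Real.sin_add_pi_div_two] at h
  refine h.congr_fun fun m => ?_
  have hI : Complex.I ^ m = Complex.exp (m * (π / 2 * Complex.I)) := by
    rw [Complex.exp_int_mul, Complex.exp_pi_div_two_mul_I]
  rw [hI, mul_comm _ (besselJ m β : ℂ), mul_assoc, ← Complex.exp_add]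
  congr 2
  push_cast
  ring
end

section
/- For every integer m ≠ 0 and every real x > 0, the Bessel function satisfies |J_m(x)| ≤ (x * Real.exp 1 / (2 * |m|)) ^ |m|. -/
open Real MeasureTheory

theorem abs_besselJ_le_one (m : ℤ) (x : ℝ) : |besselJ m x| ≤ 1 := by
  have h : ‖∫ θ in (0:ℝ)..π, Real.cos (x * Real.sin θ - m * θ)‖ ≤ 1 * |π - 0| :=
    intervalIntegral.norm_integral_le_of_norm_le_const fun θ _ => Real.abs_cos_le_one _
  rw [sub_zero, one_mul, abs_of_pos pi_pos, Real.norm_eq_abs] at h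
  rw [besselJ, abs_mul, abs_of_pos (by positivity : 0 < 1 / π), one_div, inv_mul_le_iff₀ pi_pos]
  simpa using h

theorem besselJ_neg (m : ℤ) (x : ℝ) : besselJ (-m) x = (-1) ^ m * besselJ m x := by
  have h := intervalIntegral.integral_comp_sub_left (a := 0) (b := π)
    (fun θ => Real.cos (x * Real.sin θ - (-m : ℤ) * θ)) π
  rw [sub_self, sub_zero] at h
  rw [besselJ, besselJ, ← h, mul_left_comm,
    ← intervalIntegral.integral_const_mul ((-1) ^ m)]
  congr 2
  funext θ
  rw [Real.sin_pi_sub, ← Real.cos_add_int_mul_pi]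
  congr 1
  push_cast
  ring

/-- Bessel's integral over a full period. -/
theorem two_pi_mul_besselJ (m : ℤ) (x : ℝ) :
    2 * π * besselJ m x = ∫ θ in (0:ℝ)..2 * π, Real.cos (x * Real.sin θ - m * θ) := by
  have hc : Continuous fun θ : ℝ => Real.cos (x * Real.sin θ - m * θ) := by fun_prop
  have h := intervalIntegral.integral_comp_sub_left (a := 0) (b := π)
    (fun θ => Real.cos (x * Real.sin θ - m * θ)) (2 * π)
  rw [sub_zero, show 2 * π - π = π by ring] at h
  rw [← intervalIntegral.integral_add_adjacent_intervals (hc.intervalIntegrable 0 π)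
    (hc.intervalIntegrable π (2 * π)), ← h]
  have h' : ∀ θ : ℝ, Real.cos (x * Real.sin (2 * π - θ) - m * (2 * π - θ)) =
      Real.cos (x * Real.sin θ - m * θ) := fun θ => by
    rw [Real.sin_two_pi_sub, ← Real.cos_neg, ← Real.cos_sub_int_mul_two_pi _ m]
    congr 1
    ring
  simp only [h', besselJ]
  field_simp
  ring

/-- Schläfli's contour integral for the Bessel function, over the unit circle. -/
theorem two_pi_mul_besselJ_eq_circleIntegral (n : ℕ) (x : ℝ) :
    2 * π * besselJ n x =
      (∮ z in C(0, 1), (z - 0)⁻¹ • (Complex.exp (x / 2 * (z - z⁻¹)) * (z ^ n)⁻¹)).im := by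
  have h : ∀ θ : ℝ, deriv (circleMap 0 1) θ • ((circleMap 0 1 θ - 0)⁻¹ •
      (Complex.exp (x / 2 * (circleMap 0 1 θ - (circleMap 0 1 θ)⁻¹)) * (circleMap 0 1 θ ^ n)⁻¹)) =
      Complex.I * Complex.exp ((x * Real.sin θ - n * θ : ℝ) * Complex.I) := fun θ => by
    have e : circleMap 0 1 θ = Complex.exp (θ * Complex.I) := by simp [circleMap]
    have hs : (x / 2 * (Complex.exp (θ * Complex.I) - Complex.exp (-(θ * Complex.I))) : ℂ) =
        x * Complex.sin θ * Complex.I := by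
      rw [Complex.sin, neg_mul]
      linear_combination (x / 2 * (Complex.exp (θ * Complex.I) -
        Complex.exp (-(θ * Complex.I))) : ℂ) * Complex.I_sq
    rw [deriv_circleMap, e, sub_zero, smul_eq_mul, smul_eq_mul, ← Complex.exp_neg, hs,
      ← Complex.exp_nat_mul, ← Complex.exp_neg, ← Complex.exp_add, mul_right_comm, ← mul_assoc,
      ← Complex.exp_add, add_neg_cancel, Complex.exp_zero, one_mul, mul_comm]
    congr 2
    push_cast
    ring
  have hc : Continuous fun θ : ℝ =>
      Complex.I * Complex.exp ((x * Real.sin θ - n * θ : ℝ) * Complex.I) := by fun_prop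
  rw [circleIntegral]
  simp only [h]
  rw [two_pi_mul_besselJ]
  have := Complex.imCLM.intervalIntegral_comp_comm (hc.intervalIntegrable (μ := volume) 0 (2 * π))
  rw [Complex.imCLM_apply] at this
  rw [← this]
  congr 1 with θ
  simp [Complex.exp_ofReal_mul_I_re, -Complex.ofReal_sub, -Complex.ofReal_mul]

/-- Cauchy's estimate for the generating function of the Bessel functions. -/
theorem abs_besselJ_natCast_le (n : ℕ) {x r : ℝ} (hx : 0 ≤ x) (hr : 1 ≤ r) :
    |besselJ n x| ≤ Real.exp (x / 2 * r) * (r ^ n)⁻¹ := by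
  have hr0 : 0 < r := by positivity
  have hne : ∀ z ∈ (Metric.ball (0 : ℂ) 1)ᶜ, z ≠ 0 := by
    rintro z hz rfl
    simp at hz
  have hd : ∀ z : ℂ, z ≠ 0 → DifferentiableAt ℂ
      (fun z : ℂ => Complex.exp (x / 2 * (z - z⁻¹)) * (z ^ n)⁻¹) z := fun z hz => by
    have := pow_ne_zero n hz
    fun_prop (disch := assumption)
  have hshift := Complex.circleIntegral_sub_center_inv_smul_eq_of_differentiable_on_annulus_off_countable
    (f := fun z : ℂ => Complex.exp (x / 2 * (z - z⁻¹)) * (z ^ n)⁻¹) (c := 0) one_pos hr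
    Set.countable_empty
    (fun z hz => (hd z (hne z hz.2)).continuousAt.continuousWithinAt)
    (fun z hz => hd z (hne z fun h => hz.1.2 (Metric.ball_subset_closedBall h)))
  have hbound : ∀ z ∈ Metric.sphere (0 : ℂ) r,
      ‖(z - 0)⁻¹ • (Complex.exp (x / 2 * (z - z⁻¹)) * (z ^ n)⁻¹)‖ ≤
        r⁻¹ * (Real.exp (x / 2 * r) * (r ^ n)⁻¹) := fun z hz => by
    have hz' : ‖z‖ = r := by simpa using hz
    have hre : (z - z⁻¹).re ≤ r := by
      have h1 : z.re ≤ r := hz' ▸ Complex.re_le_norm z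
      have h2 : (z - z⁻¹).re = z.re * (1 - (r ^ 2)⁻¹) := by
        rw [Complex.sub_re, Complex.inv_re, Complex.normSq_eq_norm_sq, hz']
        ring
      have h3 : (r ^ 2)⁻¹ ≤ 1 := inv_le_one_of_one_le₀ (one_le_pow₀ hr)
      have h4 : 0 < (r ^ 2)⁻¹ := by positivity
      rw [h2]
      nlinarith
    have hexp : (x / 2 * (z - z⁻¹) : ℂ).re = x / 2 * (z - z⁻¹).re := by
      rw [show (x / 2 : ℂ) = ((x / 2 : ℝ) : ℂ) by push_cast; rfl, Complex.re_ofReal_mul]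
    rw [sub_zero, norm_smul, norm_mul, norm_inv, norm_inv, norm_pow, hz', Complex.norm_exp, hexp]
    gcongr
  have h := circleIntegral.norm_integral_le_of_norm_le_const hr0.le hbound
  rw [hshift] at h
  have h' := (Complex.abs_im_le_norm _).trans h
  rw [← two_pi_mul_besselJ_eq_circleIntegral, abs_mul, abs_of_pos two_pi_pos, mul_assoc (2 * π),
    mul_inv_cancel_left₀ hr0.ne'] at h'
  exact le_of_mul_le_mul_left h' two_pi_pos

theorem abs_besselJ_natAbs (m : ℤ) (x : ℝ) : |besselJ m.natAbs x| = |besselJ m x| := by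
  rcases Int.natAbs_eq m with h | h
  · rw [← h]
  · conv_rhs => rw [h, besselJ_neg, abs_mul, abs_zpow, abs_neg, abs_one, one_zpow, one_mul]

/-- For nonzero integer order `m` and `x > 0`, `|J_m(x)| ≤ (x e / (2|m|))^{|m|}`. -/
theorem besselJ_le (m : ℤ) (hm : m ≠ 0) (x : ℝ) (hx : 0 < x) :
    |besselJ m x| ≤ (x * Real.exp 1 / (2 * |(m : ℝ)|)) ^ m.natAbs := by
  have hcast : |(m : ℝ)| = m.natAbs := by rw [Nat.cast_natAbs, Int.cast_abs]
  rw [hcast]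
  have hn : 0 < (m.natAbs : ℝ) := by exact_mod_cast Int.natAbs_pos.mpr hm
  rcases le_total x (2 * m.natAbs) with h | h
  · have := abs_besselJ_natCast_le m.natAbs hx.le ((one_le_div hx).mpr h)
    rw [abs_besselJ_natAbs] at this
    refine this.trans_eq ?_
    rw [show x / 2 * (2 * m.natAbs / x) = m.natAbs * 1 by field_simp, Real.exp_nat_mul, ← inv_pow,
      ← mul_pow, inv_div]
    ring
  · refine (abs_besselJ_le_one m x).trans (one_le_pow₀ ?_)
    rw [one_le_div (by positivity)]
    nlinarith [Real.add_one_le_exp 1]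
end

section
/- The Bessel function J_0 tends to 0 at infinity: Filter.Tendsto (fun x : ℝ => (1/π) * ∫ θ in (0)..π, Real.cos (x * Real.sin θ)) Filter.atTop (nhds 0). -/
open Real MeasureTheory
open scoped FourierTransform

/-- The substitution `u = sin θ` on `(0, π / 2)` turns the oscillatory integral with phase `sin θ`
into the Fourier transform of `u ↦ (cos (arcsin u))⁻¹` on the image of the interval. -/
theorem setIntegral_fourierChar_sin (w : ℝ) :
    ∫ u : ℝ, 𝐞 (-(u * w)) •
        (sin '' Set.Ioo 0 (π / 2)).indicator (fun u => (((cos (arcsin u))⁻¹ : ℝ) : ℂ)) u =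
      ∫ θ in Set.Ioo 0 (π / 2), ((𝐞 (-(sin θ * w)) : Circle) : ℂ) := by
  have hinj : Set.InjOn sin (Set.Ioo 0 (π / 2)) := injOn_sin.mono
    (Set.Ioo_subset_Icc_self.trans (Set.Icc_subset_Icc_left (by linarith [pi_pos])))
  have hmeas : MeasurableSet (sin '' Set.Ioo 0 (π / 2)) :=
    measurableSet_Ioo.image_of_continuousOn_injOn continuous_sin.continuousOn hinj
  have hsub := integral_image_eq_integral_abs_deriv_smul measurableSet_Ioo
    (fun θ _ => (hasDerivAt_sin θ).hasDerivWithinAt) hinj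
    (fun u => 𝐞 (-(u * w)) • (((cos (arcsin u))⁻¹ : ℝ) : ℂ))
  simp_rw [← Set.indicator_smul_apply _ (fun u => 𝐞 (-(u * w)))]
  rw [integral_indicator hmeas, hsub]
  refine setIntegral_congr_fun measurableSet_Ioo fun θ hθ => ?_
  have hcos : 0 < cos θ := cos_pos_of_mem_Ioo ⟨by linarith [hθ.1, pi_pos], hθ.2⟩
  have hcos' : (cos θ : ℂ) ≠ 0 := Complex.ofReal_ne_zero.mpr hcos.ne'
  have harcsin : arcsin (sin θ) = θ := arcsin_sin (by linarith [hθ.1, pi_pos]) hθ.2.le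
  simp only [harcsin, abs_of_pos hcos, Circle.smul_def, smul_eq_mul, Complex.real_smul,
    Complex.ofReal_inv]
  rw [mul_left_comm, mul_inv_cancel₀ hcos', mul_one]

/-- The real part of the Fourier character integral is the corresponding cosine integral. -/
theorem re_setIntegral_fourierChar_sin (x : ℝ) :
    (∫ θ in Set.Ioo 0 (π / 2), ((𝐞 (-(sin θ * (x / (2 * π)))) : Circle) : ℂ)).re =
      ∫ θ in (0 : ℝ)..(π / 2), cos (x * sin θ) := by
  have hcont : Continuous fun θ : ℝ => ((𝐞 (-(sin θ * (x / (2 * π)))) : Circle) : ℂ) := by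
    fun_prop
  have hint : IntegrableOn (fun θ : ℝ => ((𝐞 (-(sin θ * (x / (2 * π)))) : Circle) : ℂ))
      (Set.Ioo 0 (π / 2)) :=
    (hcont.continuousOn.integrableOn_compact isCompact_Icc).mono_set Set.Ioo_subset_Icc_self
  rw [intervalIntegral.integral_of_le (by positivity), integral_Ioc_eq_integral_Ioo]
  refine (integral_re hint).symm.trans (integral_congr_ae (.of_forall fun θ => ?_))
  have hphase : 2 * π * -(sin θ * (x / (2 * π))) = -(x * sin θ) := by
    field_simp
  simp only [fourierChar_apply, hphase, RCLike.re_to_complex, Complex.exp_ofReal_mul_I_re,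
    cos_neg]

/-- The symmetry `θ ↦ π - θ` of the sine folds an integral over `[0, π]` onto `[0, π / 2]`. -/
theorem integral_comp_sin_zero_pi {g : ℝ → ℝ} (hg : Continuous g) :
    ∫ θ in (0 : ℝ)..π, g (sin θ) = 2 * ∫ θ in (0 : ℝ)..(π / 2), g (sin θ) := by
  have hcont : Continuous fun θ => g (sin θ) := hg.comp continuous_sin
  have hfold : ∫ θ in (π / 2)..π, g (sin θ) = ∫ θ in (0 : ℝ)..(π / 2), g (sin θ) := by
    have h := intervalIntegral.integral_comp_sub_left (a := 0) (b := π / 2)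
      (fun θ => g (sin θ)) π
    simp only [sin_pi_sub, sub_zero, sub_half] at h
    exact h.symm
  rw [← intervalIntegral.integral_add_adjacent_intervals (hcont.intervalIntegrable 0 (π / 2))
    (hcont.intervalIntegrable (π / 2) π), hfold, two_mul]

/-- The Bessel function `J_0`, given by Bessel's integral
`J_0(x) = (1/π) ∫_0^π cos(x sin θ) dθ`, tends to `0` at infinity. -/
theorem besselJ_zero_tendsto_atTop :
    Filter.Tendsto (fun x : ℝ => (1 / π) * ∫ θ in (0:ℝ)..π, Real.cos (x * Real.sin θ))
      Filter.atTop (nhds 0) := by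
  have hRL := (Real.tendsto_integral_exp_smul_cocompact
    ((sin '' Set.Ioo 0 (π / 2)).indicator fun u => (((cos (arcsin u))⁻¹ : ℝ) : ℂ))).mono_left
    atTop_le_cocompact
  simp_rw [setIntegral_fourierChar_sin] at hRL
  have hscale : Filter.Tendsto (fun x : ℝ => x / (2 * π)) Filter.atTop Filter.atTop :=
    Filter.tendsto_id.atTop_div_const (by positivity)
  have hhalf := (Complex.continuous_re.tendsto 0).comp (hRL.comp hscale)
  simp only [Function.comp_def, re_setIntegral_fourierChar_sin, Complex.zero_re] at hhalf
  have hfold (x : ℝ) : ∫ θ in (0 : ℝ)..π, cos (x * sin θ) =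
      2 * ∫ θ in (0 : ℝ)..(π / 2), cos (x * sin θ) :=
    integral_comp_sin_zero_pi (g := fun u => cos (x * u)) (by fun_prop)
  simpa only [hfold, mul_zero] using (hhalf.const_mul 2).const_mul (1 / π)
end

section
/- Fix R > 0, λ > 0 and r₁ > 0, and for r₂ > 0 define the near-field beamforming gain g(r₂) = |J_0( (2*π*R^2/λ) * |1/(4*r₁) − 1/(4*r₂)| )|. Then g tends to 0 as r₂ tends to 0 from the right: Filter.Tendsto g (nhdsWithin 0 (Set.Ioi 0)) (nhds 0). (Corollary 1, limit of beamforming gain as the evaluation distance tends to 0.) -/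
open Real MeasureTheory

open Filter Set Topology
open scoped FourierTransform

/-- The Riemann–Lebesgue lemma after an injective change of variables. -/
theorem tendsto_setIntegral_fourierChar_comp {f f' : ℝ → ℝ} {s : Set ℝ}
    (hs : MeasurableSet s)
    (hf : ∀ x ∈ s, HasDerivWithinAt f (f' x) s x) (hinj : InjOn f s)
    (hf' : ∀ x ∈ s, f' x ≠ 0) :
    Tendsto (fun w : ℝ => ∫ x in s, (𝐞 (-(f x * w)) : ℂ)) (cocompact ℝ) (𝓝 0) := by
  have himage : MeasurableSet (f '' s) :=
    measurable_image_of_fderivWithin hs (fun x hx => (hf x hx).hasFDerivWithinAt) hinj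
  set h : ℝ → ℂ := fun u => ((|f' (Function.invFunOn f s u)|⁻¹ : ℝ) : ℂ) with h_def
  have hcancel : ∀ x ∈ s, ∀ z : ℂ, |f' x| • (z * h (f x)) = z := by
    intro x hx z
    have hne : ((|f' x| : ℝ) : ℂ) ≠ 0 := by exact_mod_cast abs_ne_zero.mpr (hf' x hx)
    simp only [h_def, hinj.leftInvOn_invFunOn hx, Complex.real_smul, Complex.ofReal_inv]
    field_simp
  refine (Real.tendsto_integral_exp_smul_cocompact ((f '' s).indicator h)).congr fun w => ?_
  have hind : ∀ u : ℝ, 𝐞 (-(u * w)) • (f '' s).indicator h u =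
      (f '' s).indicator (fun u => (𝐞 (-(u * w)) : ℂ) * h u) u := by
    intro u
    by_cases hu : u ∈ f '' s <;> simp [hu, Circle.smul_def]
  simp_rw [hind]
  rw [integral_indicator himage, integral_image_eq_integral_abs_deriv_smul hs hf hinj]
  exact setIntegral_congr_fun hs fun x hx => hcancel x hx _

/-- Decay of an oscillatory integral whose phase is injective with nonvanishing derivative. -/
theorem tendsto_setIntegral_cos_mul_comp {f f' : ℝ → ℝ} {s : Set ℝ}
    (hs : MeasurableSet s) (hs_fin : volume s ≠ ⊤) (hcont : Continuous f)
    (hf : ∀ x ∈ s, HasDerivWithinAt f (f' x) s x) (hinj : InjOn f s)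
    (hf' : ∀ x ∈ s, f' x ≠ 0) :
    Tendsto (fun y : ℝ => ∫ x in s, Real.cos (y * f x)) atTop (𝓝 0) := by
  have hlim : Tendsto (fun y : ℝ => y / (2 * π)) atTop (cocompact ℝ) :=
    (tendsto_id.atTop_div_const (by positivity)).mono_right atTop_le_cocompact
  have hre := (Complex.continuous_re.tendsto 0).comp
    ((tendsto_setIntegral_fourierChar_comp hs hf hinj hf').comp hlim)
  refine hre.congr fun y => ?_
  have hint : IntegrableOn (fun x => (𝐞 (-(f x * (y / (2 * π)))) : ℂ)) s := by
    refine Measure.integrableOn_of_bounded (M := 1) hs_fin ?_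
      (Eventually.of_forall fun x => (Circle.norm_coe _).le)
    exact (by fun_prop : Continuous fun x => (𝐞 (-(f x * (y / (2 * π)))) : ℂ)).aestronglyMeasurable
  have hcomm := integral_re hint
  simp only [Function.comp_apply]
  refine Eq.trans hcomm.symm (integral_congr_ae (Eventually.of_forall fun x => ?_))
  have harg : 2 * π * -(f x * (y / (2 * π))) = -(y * f x) := by
    field_simp
  simp only [Real.fourierChar_apply, harg]
  simpa using Complex.exp_ofReal_mul_I_re (-(y * f x))

theorem tendsto_besselJ_zero_atTop : Tendsto (besselJ 0) atTop (𝓝 0) := by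
  have hleft : Tendsto (fun y : ℝ => ∫ θ in Ioo 0 (π / 2), Real.cos (y * Real.sin θ))
      atTop (𝓝 0) := by
    refine tendsto_setIntegral_cos_mul_comp measurableSet_Ioo (by simp) Real.continuous_sin
      (fun θ _ => (Real.hasDerivAt_sin θ).hasDerivWithinAt) ?_ fun θ hθ => ?_
    · exact Real.injOn_sin.mono
        (Ioo_subset_Icc_self.trans (Icc_subset_Icc_left (by linarith [pi_pos])))
    · exact (Real.cos_pos_of_mem_Ioo ⟨by linarith [hθ.1, pi_pos], hθ.2⟩).ne'
  have hint : ∀ y a b : ℝ,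
      IntervalIntegrable (fun θ => Real.cos (y * Real.sin θ)) volume a b := fun y a b =>
    (by fun_prop : Continuous fun θ => Real.cos (y * Real.sin θ)).intervalIntegrable a b
  have heq : ∀ y : ℝ, besselJ 0 y =
      (2 / π) * ∫ θ in Ioo 0 (π / 2), Real.cos (y * Real.sin θ) := by
    intro y
    have hreflect : ∫ θ in (π / 2)..π, Real.cos (y * Real.sin θ) =
        ∫ θ in (0 : ℝ)..(π / 2), Real.cos (y * Real.sin θ) := by
      have h := intervalIntegral.integral_comp_sub_left (a := 0) (b := π / 2)
        (fun θ => Real.cos (y * Real.sin θ)) π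
      simp only [Real.sin_pi_sub, sub_zero, sub_half] at h
      exact h.symm
    simp only [besselJ, Int.cast_zero, zero_mul, sub_zero]
    rw [← intervalIntegral.integral_add_adjacent_intervals (hint y 0 (π / 2)) (hint y (π / 2) π),
      hreflect, intervalIntegral.integral_of_le (by positivity), integral_Ioc_eq_integral_Ioo]
    ring
  rw [funext heq]
  simpa using hleft.const_mul (2 / π)

/-- Corollary 1 (limit as the evaluation distance tends to `0` from the right):
the UCA near-field beamforming gain `g(r₂) = |J_0((2πR²/λ)|1/(4r₁) − 1/(4r₂)|)|`
tends to `0` as `r₂ → 0⁺`. -/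
theorem gain_tendsto_zero (R lam r₁ : ℝ) (hR : 0 < R) (hlam : 0 < lam) (hr₁ : 0 < r₁) :
    Filter.Tendsto
      (fun r₂ : ℝ => |besselJ 0 ((2 * π * R ^ 2 / lam) * |1 / (4 * r₁) - 1 / (4 * r₂)|)|)
      (nhdsWithin 0 (Set.Ioi 0)) (nhds 0) := by
  have hinv : Tendsto (fun r₂ : ℝ => 1 / (4 * r₂)) (𝓝[>] 0) atTop := by
    refine (tendsto_inv_nhdsGT_zero.const_mul_atTop (by norm_num : (0 : ℝ) < 1 / 4)).congr
      fun r => ?_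
    rw [one_div_mul_eq_div, one_div, mul_inv]
    ring
  have habs : Tendsto (fun r₂ : ℝ => |1 / (4 * r₁) - 1 / (4 * r₂)|) (𝓝[>] 0) atTop :=
    tendsto_abs_atBot_atTop.comp
      (tendsto_atBot_add_const_left _ (1 / (4 * r₁)) (tendsto_neg_atTop_atBot.comp hinv))
  have hzeta := habs.const_mul_atTop (by positivity : 0 < 2 * π * R ^ 2 / lam)
  simpa using (tendsto_besselJ_zero_atTop.comp hzeta).abs
end

section
/- For every real x > 0, the Bessel function satisfies |J_0(x)| ≤ Real.sqrt (2 / (π * x)). -/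
open Real MeasureTheory

/-- The integrand `exp (i x z) / √(1 - z²)` of the Poisson representation of `J_0`. -/
noncomputable def poissonKernel₀ (x : ℝ) (z : ℂ) : ℂ :=
  Complex.exp (x * z * Complex.I) * (1 - z ^ 2) ^ (-(1 / 2) : ℂ)

theorem one_sub_sq_re (a s : ℝ) :
    (1 - ((a : ℂ) + s * Complex.I) ^ 2).re = 1 - a ^ 2 + s ^ 2 := by
  simp [pow_two]
  ring

theorem differentiableOn_poissonKernel₀ (x : ℝ) {a : ℝ} (ha0 : 0 ≤ a) (ha1 : a < 1) (S : Set ℝ) :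
    DifferentiableOn ℂ (poissonKernel₀ x) (Set.uIcc 0 a ×ℂ S) := by
  intro z hz
  have hre := hz.1
  rw [Set.mem_preimage, Set.uIcc_of_le ha0] at hre
  have hslit : 1 - z ^ 2 ∈ Complex.slitPlane := by
    left
    rw [← Complex.re_add_im z, one_sub_sq_re]
    nlinarith [hre.1, hre.2, sq_nonneg z.im]
  unfold poissonKernel₀
  refine DifferentiableAt.differentiableWithinAt ?_
  exact DifferentiableAt.mul (by fun_prop) (DifferentiableAt.cpow (by fun_prop) (by fun_prop) hslit)

theorem norm_poissonKernel₀ (x a s : ℝ) (h : 0 < 1 - a ^ 2 + s ^ 2) :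
    ‖poissonKernel₀ x (a + s * Complex.I)‖ =
      Real.exp (-(x * s)) * ‖1 - ((a : ℂ) + s * Complex.I) ^ 2‖ ^ (-(1 / 2) : ℝ) := by
  have hne : (1 - ((a : ℂ) + s * Complex.I) ^ 2) ≠ 0 := by
    intro h0
    have := one_sub_sq_re a s
    rw [h0, Complex.zero_re] at this
    linarith
  have hexp : (-(1 / 2) : ℂ) = ((-(1 / 2) : ℝ) : ℂ) := by push_cast; rfl
  rw [poissonKernel₀, norm_mul, Complex.norm_exp, hexp, Complex.norm_cpow_real]
  congr 2
  simp

theorem norm_poissonKernel₀_le_exp (x : ℝ) {a R : ℝ} (ha : a ^ 2 < 1) (hR : 1 ≤ R) :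
    ‖poissonKernel₀ x (a + R * Complex.I)‖ ≤ Real.exp (-(x * R)) := by
  rw [norm_poissonKernel₀ x a R (by nlinarith)]
  refine mul_le_of_le_one_right (Real.exp_pos _).le
    (Real.rpow_le_one_of_one_le_of_nonpos ?_ (by norm_num))
  refine le_trans ?_ (Complex.re_le_norm _)
  rw [one_sub_sq_re]
  nlinarith

theorem norm_poissonKernel₀_le (x : ℝ) {a s : ℝ} (ha0 : 0 ≤ a) (ha1 : a < 1) (hs : 0 < s) :
    ‖poissonKernel₀ x (a + s * Complex.I)‖ ≤
      (1 + a) ^ (-(1 / 2) : ℝ) * (s ^ ((1 / 2 : ℝ) - 1) * Real.exp (-(x * s))) := by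
  rw [norm_poissonKernel₀ x a s (by nlinarith)]
  have hnorm : (1 + a) * s ≤ ‖1 - ((a : ℂ) + s * Complex.I) ^ 2‖ := by
    have hfac : 1 - ((a : ℂ) + s * Complex.I) ^ 2 =
        (1 + (a + s * Complex.I)) * (1 - (a + s * Complex.I)) := by ring
    rw [hfac, norm_mul]
    gcongr
    · refine le_trans (le_of_eq ?_) (Complex.re_le_norm _)
      simp
    · refine le_trans ?_ (Complex.abs_im_le_norm _)
      simp [le_abs_self]
  have hpow := Real.rpow_le_rpow_of_nonpos (by positivity) hnorm
    (by norm_num : (-(1 / 2) : ℝ) ≤ 0)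
  rw [Real.mul_rpow (by positivity) hs.le] at hpow
  rw [show (1 / 2 : ℝ) - 1 = -(1 / 2) by norm_num]
  calc _ ≤ Real.exp (-(x * s)) * ((1 + a) ^ (-(1 / 2) : ℝ) * s ^ (-(1 / 2) : ℝ)) := by gcongr
    _ = _ := by ring

theorem poissonKernel₀_mul_I (x s : ℝ) :
    poissonKernel₀ x (s * Complex.I) =
      ((Real.exp (-(x * s)) * (1 + s ^ 2) ^ (-(1 / 2) : ℝ) : ℝ) : ℂ) := by
  rw [poissonKernel₀, Complex.ofReal_mul, Complex.ofReal_cpow (by positivity)]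
  push_cast
  congr 2
  · linear_combination (x * s : ℂ) * Complex.I_sq
  · linear_combination (-(s : ℂ) ^ 2) * Complex.I_sq

theorem re_poissonKernel₀_ofReal (x : ℝ) {t : ℝ} (ht : t ^ 2 ≤ 1) :
    (poissonKernel₀ x t).re = Real.cos (x * t) * (1 - t ^ 2) ^ (-(1 / 2) : ℝ) := by
  have h : ((1 : ℂ) - (t : ℂ) ^ 2) ^ (-(1 / 2) : ℂ) =
      (((1 - t ^ 2) ^ (-(1 / 2) : ℝ) : ℝ) : ℂ) := by
    rw [Complex.ofReal_cpow (by linarith)]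
    push_cast
    rfl
  rw [poissonKernel₀, h, Complex.re_mul_ofReal, ← Complex.ofReal_mul, Complex.exp_ofReal_mul_I_re]

theorem integral_cos_mul_sin_eq (x : ℝ) {b : ℝ} (hb0 : 0 ≤ b) (hb : b < π / 2) :
    ∫ θ in (0 : ℝ)..b, Real.cos (x * Real.sin θ) =
      (∫ t in (0 : ℝ)..Real.sin b, poissonKernel₀ x t).re := by
  have hsin0 : 0 ≤ Real.sin b := Real.sin_nonneg_of_nonneg_of_le_pi hb0 (by linarith)
  have hsin1 : Real.sin b < 1 := by
    rw [← Real.sin_pi_div_two]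
    exact Real.sin_lt_sin_of_lt_of_le_pi_div_two (by linarith) le_rfl hb
  have hcont : ContinuousOn (fun t : ℝ => poissonKernel₀ x t) (Set.uIcc 0 (Real.sin b)) := by
    refine (differentiableOn_poissonKernel₀ x hsin0 hsin1 {0}).continuousOn.comp
      Complex.continuous_ofReal.continuousOn ?_
    intro t ht
    exact ⟨ht, by simp⟩
  have hmaps : Real.sin '' Set.uIcc 0 b ⊆ Set.uIcc 0 (Real.sin b) := by
    rintro _ ⟨θ, hθ, rfl⟩
    rw [Set.uIcc_of_le hb0] at hθ
    rw [Set.uIcc_of_le hsin0]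
    exact ⟨Real.sin_nonneg_of_nonneg_of_le_pi hθ.1 (by linarith [hθ.2]),
      Real.sin_le_sin_of_le_of_le_pi_div_two (by linarith [hθ.1]) hb.le hθ.2⟩
  have hre : (∫ t in (0 : ℝ)..Real.sin b, poissonKernel₀ x t).re =
      ∫ t in (0 : ℝ)..Real.sin b, (poissonKernel₀ x t).re :=
    (Complex.reCLM.intervalIntegral_comp_comm hcont.intervalIntegrable).symm
  have hsubst := intervalIntegral.integral_comp_mul_deriv'' (a := 0) (b := b)
    (f := Real.sin) (f' := Real.cos) (g := fun t : ℝ => (poissonKernel₀ x t).re)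
    Real.continuous_sin.continuousOn (fun θ _ => (Real.hasDerivAt_sin θ).hasDerivWithinAt)
    Real.continuous_cos.continuousOn
    (Complex.continuous_re.comp_continuousOn (hcont.mono hmaps))
  rw [Real.sin_zero] at hsubst
  rw [hre, ← hsubst]
  refine intervalIntegral.integral_congr fun θ hθ => ?_
  rw [Set.uIcc_of_le hb0] at hθ
  have hcos : 0 < Real.cos θ :=
    Real.cos_pos_of_mem_Ioo ⟨by linarith [hθ.1, Real.pi_pos], by linarith [hθ.2]⟩
  simp only [Function.comp]
  rw [re_poissonKernel₀_ofReal x (Real.sin_sq_le_one θ), ← Real.cos_sq',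
    ← Real.rpow_natCast, ← Real.rpow_mul hcos.le]
  norm_num [Real.rpow_neg_one, hcos.ne']

theorem norm_integral_vertical_le {x a R : ℝ} (hx : 0 < x) (ha0 : 0 ≤ a) (ha1 : a < 1)
    (hR : 0 ≤ R) :
    ‖∫ s in (0 : ℝ)..R, poissonKernel₀ x (a + s * Complex.I)‖ ≤
      (1 + a) ^ (-(1 / 2) : ℝ) * √(π / x) := by
  have hGamma := Real.integral_rpow_mul_exp_neg_mul_Ioi (a := 1 / 2) (by norm_num) hx
  have hint : IntegrableOn (fun s : ℝ => s ^ ((1 / 2 : ℝ) - 1) * Real.exp (-(x * s)))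
      (Set.Ioi 0) := by
    refine Integrable.of_integral_ne_zero ?_
    rw [hGamma, Real.Gamma_one_half_eq]
    positivity
  have hsub : Set.Ioc 0 R ⊆ Set.Ioi (0 : ℝ) := fun s hs => hs.1
  calc ‖∫ s in (0 : ℝ)..R, poissonKernel₀ x (a + s * Complex.I)‖
      ≤ ∫ s in (0 : ℝ)..R,
          (1 + a) ^ (-(1 / 2) : ℝ) * (s ^ ((1 / 2 : ℝ) - 1) * Real.exp (-(x * s))) := by
        refine intervalIntegral.norm_integral_le_of_norm_le hR
          (Filter.Eventually.of_forall fun s hs => norm_poissonKernel₀_le x ha0 ha1 hs.1) ?_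
        rw [intervalIntegrable_iff_integrableOn_Ioc_of_le hR]
        exact (hint.mono_set hsub).const_mul _
    _ ≤ (1 + a) ^ (-(1 / 2) : ℝ) *
          ∫ s in Set.Ioi (0 : ℝ), s ^ ((1 / 2 : ℝ) - 1) * Real.exp (-(x * s)) := by
        rw [intervalIntegral.integral_const_mul, intervalIntegral.integral_of_le hR]
        refine mul_le_mul_of_nonneg_left (setIntegral_mono_set hint ?_ hsub.eventuallyLE)
          (by positivity)
        refine (ae_restrict_mem measurableSet_Ioi).mono fun s hs => ?_
        have hs0 : (0 : ℝ) < s := hs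
        simp only [Pi.zero_apply]
        positivity
    _ = (1 + a) ^ (-(1 / 2) : ℝ) * √(π / x) := by
        rw [hGamma, Real.Gamma_one_half_eq, ← Real.sqrt_eq_rpow, ← Real.sqrt_mul (by positivity)]
        congr 2
        ring

theorem abs_integral_cos_mul_sin_le {x b : ℝ} (hx : 0 < x) (hb0 : 0 ≤ b) (hb : b < π / 2) :
    |∫ θ in (0 : ℝ)..b, Real.cos (x * Real.sin θ)| ≤
      (1 + Real.sin b) ^ (-(1 / 2) : ℝ) * √(π / x) := by
  have ha0 : 0 ≤ Real.sin b := Real.sin_nonneg_of_nonneg_of_le_pi hb0 (by linarith)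
  have ha1 : Real.sin b < 1 := by
    rw [← Real.sin_pi_div_two]
    exact Real.sin_lt_sin_of_lt_of_le_pi_div_two (by linarith) le_rfl hb
  rw [integral_cos_mul_sin_eq x hb0 hb]
  set a := Real.sin b
  have hbound : ∀ R : ℝ, 1 ≤ R → |(∫ t in (0 : ℝ)..a, poissonKernel₀ x t).re| ≤
      Real.exp (-(x * R)) + (1 + a) ^ (-(1 / 2) : ℝ) * √(π / x) := by
    intro R hR
    have hrect := Complex.integral_boundary_rect_eq_zero_of_differentiableOn (poissonKernel₀ x)
      0 (a + R * Complex.I) (by simpa using differentiableOn_poissonKernel₀ x ha0 ha1 _)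
    simp only [Complex.zero_re, Complex.zero_im, Complex.add_re, Complex.add_im, Complex.mul_re,
      Complex.mul_im, Complex.ofReal_re, Complex.ofReal_im, Complex.I_re, Complex.I_im,
      Complex.ofReal_zero, zero_mul, mul_zero, mul_one, add_zero, zero_add, sub_zero,
      poissonKernel₀_mul_I, intervalIntegral.integral_ofReal, smul_eq_mul] at hrect
    have hre := congrArg Complex.re hrect
    simp only [Complex.add_re, Complex.sub_re, Complex.re_mul_ofReal, Complex.I_re, zero_mul,
      sub_zero, Complex.zero_re] at hre
    have htop : ‖∫ t in (0 : ℝ)..a, poissonKernel₀ x (t + R * Complex.I)‖ ≤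
        Real.exp (-(x * R)) := by
      refine (intervalIntegral.norm_integral_le_of_norm_le_const fun t ht => ?_).trans
        (mul_le_of_le_one_right (Real.exp_pos (-(x * R))).le ?_)
      · rw [Set.uIoc_of_le ha0] at ht
        exact norm_poissonKernel₀_le_exp x (by nlinarith [ht.1, ht.2]) hR
      · rw [sub_zero, abs_of_nonneg ha0]
        exact ha1.le
    have hright := norm_integral_vertical_le hx ha0 ha1 (zero_le_one.trans hR)
    have hright' := Complex.abs_re_le_norm
      (Complex.I * ∫ s in (0 : ℝ)..R, poissonKernel₀ x (a + s * Complex.I))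
    rw [norm_mul, Complex.norm_I, one_mul] at hright'
    have htop' := Complex.abs_re_le_norm
      (∫ t in (0 : ℝ)..a, poissonKernel₀ x (t + R * Complex.I))
    rw [abs_le] at *
    constructor <;> linarith
  have hlim : Filter.Tendsto (fun R : ℝ => Real.exp (-(x * R)) +
      (1 + a) ^ (-(1 / 2) : ℝ) * √(π / x)) Filter.atTop
      (nhds (0 + (1 + a) ^ (-(1 / 2) : ℝ) * √(π / x))) :=
    (Real.tendsto_exp_neg_atTop_nhds_zero.comp
      (Filter.tendsto_id.const_mul_atTop hx)).add_const _
  rw [zero_add] at hlim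
  exact ge_of_tendsto hlim ((Filter.eventually_ge_atTop 1).mono hbound)

theorem abs_integral_cos_mul_sin_pi_div_two_le {x : ℝ} (hx : 0 < x) :
    |∫ θ in (0 : ℝ)..π / 2, Real.cos (x * Real.sin θ)| ≤
      2 ^ (-(1 / 2) : ℝ) * √(π / x) := by
  have hcont : Continuous fun θ : ℝ => Real.cos (x * Real.sin θ) := by fun_prop
  have hleft : Continuous fun b : ℝ => |∫ θ in (0 : ℝ)..b, Real.cos (x * Real.sin θ)| :=
    (intervalIntegral.continuous_primitive (fun u v => hcont.intervalIntegrable u v) 0).abs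
  have hright : ContinuousAt (fun b : ℝ => (1 + Real.sin b) ^ (-(1 / 2) : ℝ) * √(π / x))
      (π / 2) := by
    refine ContinuousAt.mul (ContinuousAt.rpow_const (by fun_prop) (Or.inl ?_)) continuousAt_const
    norm_num
  have hle := le_of_tendsto_of_tendsto (b := nhdsWithin (π / 2) (Set.Iio (π / 2)))
    (hleft.continuousAt.tendsto.mono_left nhdsWithin_le_nhds)
    (hright.tendsto.mono_left nhdsWithin_le_nhds) (by
      filter_upwards [Ioo_mem_nhdsLT Real.pi_div_two_pos] with b hb
      exact abs_integral_cos_mul_sin_le hx hb.1.le hb.2)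
  rw [Real.sin_pi_div_two] at hle
  norm_num at hle ⊢
  exact hle

theorem integral_cos_mul_sin_pi (x : ℝ) :
    ∫ θ in (0 : ℝ)..π, Real.cos (x * Real.sin θ) =
      2 * ∫ θ in (0 : ℝ)..π / 2, Real.cos (x * Real.sin θ) := by
  have hcont : Continuous fun θ : ℝ => Real.cos (x * Real.sin θ) := by fun_prop
  have hrefl := intervalIntegral.integral_comp_sub_left (a := 0) (b := π / 2)
    (fun θ : ℝ => Real.cos (x * Real.sin θ)) π
  simp only [Real.sin_pi_sub, sub_zero, sub_half] at hrefl
  rw [← intervalIntegral.integral_add_adjacent_intervals (hcont.intervalIntegrable 0 (π / 2))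
    (hcont.intervalIntegrable (π / 2) π), ← hrefl, two_mul]

/-- For every `x > 0`, `|J_0(x)| ≤ √(2/(πx))`. -/
theorem besselJ_zero_le (x : ℝ) (hx : 0 < x) :
    |besselJ 0 x| ≤ Real.sqrt (2 / (π * x)) := by
  have h := abs_integral_cos_mul_sin_pi_div_two_le hx
  rw [Real.rpow_neg zero_le_two, ← Real.sqrt_eq_rpow, ← Real.sqrt_inv,
    ← Real.sqrt_mul (by positivity)] at h
  simp only [besselJ, Int.cast_zero, zero_mul, sub_zero]
  rw [integral_cos_mul_sin_pi, abs_mul, abs_mul, abs_of_pos (by positivity : 0 < 1 / π),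
    abs_two, ← mul_assoc]
  calc _ ≤ 1 / π * 2 * √(2⁻¹ * (π / x)) := by gcongr
    _ = √((2 / π) ^ 2 * (2⁻¹ * (π / x))) := by
        rw [Real.sqrt_mul (sq_nonneg (2 / π)), Real.sqrt_sq (by positivity)]
        ring
    _ = √(2 / (π * x)) := by
        congr 1
        field_simp
end

section
/- Let R > 0, λ > 0 and r₁, r₂ > 0 with r₁ ≠ r₂, and set ζ = (2*π*R^2/λ) * |1/(4*r₁) − 1/(4*r₂)|. Then the near-field beamforming gain satisfies |J_0(ζ)| ≤ (2/(π*R)) * Real.sqrt (λ * r₁ * r₂ / |r₂ − r₁|). (Corollary 2: upper bound of the UCA near-field beamforming gain in the distance domain.) -/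
open Real MeasureTheory

/-- The integrand `exp (ixz) / √(1 - z²)` of the Poisson representation of `J₀`. -/
noncomputable def poissonIntegrand (x : ℝ) (z : ℂ) : ℂ :=
  Complex.exp (x * z * Complex.I) * (1 - z ^ 2) ^ ((-(1 / 2) : ℝ) : ℂ)

lemma one_sub_sq_mem_slitPlane {z : ℂ} (hz : |z.re| < 1) : 1 - z ^ 2 ∈ Complex.slitPlane := by
  obtain ⟨h1, h2⟩ := abs_lt.mp hz
  rw [Complex.mem_slitPlane_iff]
  by_contra! h
  simp only [Complex.sub_re, Complex.sub_im, Complex.one_re, Complex.one_im, pow_two,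
    Complex.mul_re, Complex.mul_im] at h
  obtain ⟨h3, h4⟩ := h
  have h5 : z.re * z.im = 0 := by linarith
  rcases mul_eq_zero.mp h5 with h6 | h6 <;> rw [h6] at h3 <;> nlinarith

lemma differentiableAt_poissonIntegrand (x : ℝ) {z : ℂ} (hz : |z.re| < 1) :
    DifferentiableAt ℂ (poissonIntegrand x) z := by
  unfold poissonIntegrand
  refine DifferentiableAt.mul (by fun_prop) ?_
  exact DifferentiableAt.cpow (by fun_prop) (by fun_prop) (one_sub_sq_mem_slitPlane hz)

lemma norm_poissonIntegrand (x : ℝ) (z : ℂ) :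
    ‖poissonIntegrand x z‖ = rexp (-(x * z.im)) * (‖1 - z‖ * ‖1 + z‖) ^ (-(1 / 2) : ℝ) := by
  rw [poissonIntegrand, norm_mul, Complex.norm_exp, Complex.norm_cpow_real, ← norm_mul]
  congr 2
  · simp
  · ring_nf

lemma norm_poissonIntegrand_vertical_le (x : ℝ) {a c t : ℝ} (ha : 0 < a) (hc : |c| = a)
    (ht : 0 < t) :
    ‖poissonIntegrand x (c + t * Complex.I)‖ ≤
      (1 + a) ^ (-(1 / 2) : ℝ) * (t ^ ((1 / 2 : ℝ) - 1) * rexp (-(x * t))) := by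
  have key : (1 + a) * t ≤
      ‖1 - ((c : ℂ) + t * Complex.I)‖ * ‖1 + ((c : ℂ) + t * Complex.I)‖ := by
    have h1 := Complex.abs_re_le_norm (1 - ((c : ℂ) + t * Complex.I))
    have h2 := Complex.abs_im_le_norm (1 - ((c : ℂ) + t * Complex.I))
    have h3 := Complex.abs_re_le_norm (1 + ((c : ℂ) + t * Complex.I))
    have h4 := Complex.abs_im_le_norm (1 + ((c : ℂ) + t * Complex.I))
    simp [abs_of_pos ht] at h1 h2 h3 h4
    rcases abs_choice c with h | h
    · rw [mul_comm]
      exact mul_le_mul h2 (by linarith [le_abs_self (1 + c)]) (by linarith) (norm_nonneg _)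
    · exact mul_le_mul (by linarith [le_abs_self (1 - c)]) h4 ht.le (norm_nonneg _)
  rw [norm_poissonIntegrand]
  have him : ((c : ℂ) + t * Complex.I).im = t := by simp
  have hexp : (-(1 / 2) : ℝ) = 1 / 2 - 1 := by norm_num
  calc _ ≤ rexp (-(x * t)) * ((1 + a) * t) ^ (-(1 / 2) : ℝ) := by
        rw [him]
        gcongr ?_ * ?_
        exact rpow_le_rpow_of_nonpos (by positivity) key (by norm_num)
    _ = _ := by
        rw [mul_rpow (by positivity) ht.le, ← hexp]
        ring

lemma norm_integral_poissonIntegrand_vertical_le {x a c T : ℝ} (hx : 0 < x) (ha : 0 < a)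
    (hc : |c| = a) (hT : 0 ≤ T) :
    ‖∫ t in (0 : ℝ)..T, poissonIntegrand x (c + t * Complex.I)‖ ≤
      (1 + a) ^ (-(1 / 2) : ℝ) * √(π / x) := by
  have hval := Real.integral_rpow_mul_exp_neg_mul_Ioi (a := 1 / 2) (r := x) (by norm_num) hx
  have hintegrable : IntegrableOn (fun t : ℝ ↦ t ^ ((1 / 2 : ℝ) - 1) * rexp (-(x * t)))
      (Set.Ioi 0) := by
    refine Integrable.of_integral_ne_zero ?_
    rw [hval]
    have := Real.Gamma_pos_of_pos (s := 1 / 2) (by norm_num)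
    positivity
  rw [Real.Gamma_one_half_eq, ← sqrt_eq_rpow, ← sqrt_mul (by positivity),
    show 1 / x * π = π / x by ring] at hval
  have hsub : Set.Ioc 0 T ⊆ Set.Ioi (0 : ℝ) := fun t ht ↦ ht.1
  calc _ ≤ ∫ t in (0 : ℝ)..T,
          (1 + a) ^ (-(1 / 2) : ℝ) * (t ^ ((1 / 2 : ℝ) - 1) * rexp (-(x * t))) := by
        refine intervalIntegral.norm_integral_le_of_norm_le hT ?_ ?_
        · exact ae_of_all _ fun t ht ↦ norm_poissonIntegrand_vertical_le x ha hc ht.1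
        · rw [intervalIntegrable_iff_integrableOn_Ioc_of_le hT]
          exact (hintegrable.mono_set hsub).const_mul _
    _ ≤ _ := by
        rw [intervalIntegral.integral_const_mul, intervalIntegral.integral_of_le hT, ← hval]
        gcongr
        · filter_upwards [self_mem_ae_restrict measurableSet_Ioi] with t ht
          have : 0 < t := ht
          positivity

lemma norm_integral_poissonIntegrand_horizontal_le {x a T : ℝ} (hx : 0 < x) (ha : 0 < a)
    (hT : 0 < T) :
    ‖∫ u in (-a)..a, poissonIntegrand x (u + T * Complex.I)‖ ≤ T⁻¹ * (2 * a) := by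
  have h := intervalIntegral.norm_integral_le_of_norm_le_const (a := -a) (b := a) (C := T⁻¹)
    (f := fun u : ℝ ↦ poissonIntegrand x (u + T * Complex.I)) ?_
  · rwa [show |a - -a| = 2 * a by rw [abs_of_pos] <;> linarith] at h
  intro u _
  have h2 := Complex.abs_im_le_norm (1 - ((u : ℂ) + T * Complex.I))
  have h4 := Complex.abs_im_le_norm (1 + ((u : ℂ) + T * Complex.I))
  simp [abs_of_pos hT] at h2 h4
  have key : T ^ 2 ≤ ‖1 - ((u : ℂ) + T * Complex.I)‖ * ‖1 + ((u : ℂ) + T * Complex.I)‖ := by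
    rw [pow_two]
    gcongr
  rw [norm_poissonIntegrand]
  have him : ((u : ℂ) + T * Complex.I).im = T := by simp
  calc _ ≤ 1 * (T ^ 2) ^ (-(1 / 2) : ℝ) := by
        rw [him]
        refine mul_le_mul (exp_le_one_iff.mpr (by nlinarith [mul_pos hx hT]))
          (rpow_le_rpow_of_nonpos (by positivity) key (by norm_num)) (by positivity) zero_le_one
    _ = _ := by
        rw [rpow_neg (by positivity), ← sqrt_eq_rpow, sqrt_sq hT.le, one_mul]

lemma norm_integral_poissonIntegrand_le {x a : ℝ} (hx : 0 < x) (ha : 0 < a) (ha1 : a < 1) :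
    ‖∫ u in (-a)..a, poissonIntegrand x u‖ ≤ 2 * ((1 + a) ^ (-(1 / 2) : ℝ) * √(π / x)) := by
  have bound : ∀ T : ℝ, 0 < T → ‖∫ u in (-a)..a, poissonIntegrand x u‖ ≤
      2 * ((1 + a) ^ (-(1 / 2) : ℝ) * √(π / x)) + T⁻¹ * (2 * a) := by
    intro T hT
    have hrect := Complex.integral_boundary_rect_eq_zero_of_differentiableOn
      (poissonIntegrand x) (-a : ℝ) (a + T * Complex.I) ?_
    · simp only [Complex.ofReal_re, Complex.ofReal_im, Complex.add_re, Complex.add_im,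
        Complex.mul_re, Complex.mul_im, Complex.I_re, Complex.I_im, mul_zero, mul_one, zero_mul,
        sub_zero, add_zero, zero_add, Complex.ofReal_zero] at hrect
      have h1 := norm_integral_poissonIntegrand_vertical_le hx ha (abs_of_pos ha) hT.le
      have h2 := norm_integral_poissonIntegrand_vertical_le (c := -a) hx ha
        (by rw [abs_neg, abs_of_pos ha]) hT.le
      have h3 := norm_integral_poissonIntegrand_horizontal_le hx ha hT
      set A := ∫ u in (-a)..a, poissonIntegrand x u
      set B := ∫ u in (-a)..a, poissonIntegrand x (u + T * Complex.I)
      set C := ∫ t in (0 : ℝ)..T, poissonIntegrand x (a + t * Complex.I)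
      set D := ∫ t in (0 : ℝ)..T, poissonIntegrand x ((-a : ℝ) + t * Complex.I)
      have hA : A = B - Complex.I * C + Complex.I * D := by
        simp only [smul_eq_mul] at hrect
        linear_combination hrect
      calc ‖A‖ ≤ ‖B‖ + ‖Complex.I * C‖ + ‖Complex.I * D‖ := by
            rw [hA]
            exact (norm_add_le _ _).trans (add_le_add_left (norm_sub_le _ _) _)
        _ ≤ _ := by
            simp only [norm_mul, Complex.norm_I, one_mul]
            linarith
    · intro z hz
      refine (differentiableAt_poissonIntegrand x ?_).differentiableWithinAt
      have hz' := (Complex.mem_reProdIm.mp hz).1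
      simp only [Complex.ofReal_re, Complex.add_re, Complex.mul_re, Complex.I_re, Complex.I_im,
        Complex.ofReal_im, mul_zero, mul_one, sub_zero, add_zero] at hz'
      rw [Set.uIcc_of_le (by linarith)] at hz'
      exact abs_lt.mpr ⟨by linarith [hz'.1], by linarith [hz'.2]⟩
  have hlim : Filter.Tendsto
      (fun T : ℝ ↦ 2 * ((1 + a) ^ (-(1 / 2) : ℝ) * √(π / x)) + T⁻¹ * (2 * a)) Filter.atTop
      (nhds (2 * ((1 + a) ^ (-(1 / 2) : ℝ) * √(π / x)) + 0 * (2 * a))) :=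
    (tendsto_inv_atTop_zero.mul_const _).const_add _
  rw [zero_mul, add_zero] at hlim
  exact ge_of_tendsto hlim ((Filter.eventually_gt_atTop 0).mono bound)

lemma poissonIntegrand_sin_mul_cos (x : ℝ) {θ : ℝ} (hθ : 0 < cos θ) :
    cos θ • poissonIntegrand x (sin θ : ℝ) = Complex.exp ((x * sin θ : ℝ) * Complex.I) := by
  have h : (1 - ((sin θ : ℝ) : ℂ) ^ 2) ^ ((-(1 / 2) : ℝ) : ℂ) = ((cos θ)⁻¹ : ℝ) := by
    rw [show (1 - ((sin θ : ℝ) : ℂ) ^ 2) = ((cos θ ^ 2 : ℝ) : ℂ) by rw [cos_sq']; push_cast; rfl,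
      ← Complex.ofReal_cpow (by positivity), rpow_neg (by positivity), ← sqrt_eq_rpow,
      sqrt_sq hθ.le]
  have hne : ((cos θ : ℝ) : ℂ) ≠ 0 := by exact_mod_cast hθ.ne'
  rw [poissonIntegrand, h, Complex.real_smul, Complex.ofReal_inv, Complex.ofReal_mul]
  field_simp

lemma integral_exp_sin_eq (x : ℝ) {b : ℝ} (hb : 0 < b) (hb_lt : b < π / 2) :
    ∫ θ in (-b)..b, Complex.exp ((x * sin θ : ℝ) * Complex.I) =
      ∫ u in (-sin b)..sin b, poissonIntegrand x u := by
  have hcos : ∀ θ ∈ Set.uIcc (-b) b, 0 < cos θ := by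
    intro θ hθ
    rw [Set.uIcc_of_le (by linarith)] at hθ
    exact cos_pos_of_mem_Ioo ⟨by linarith [hθ.1], by linarith [hθ.2]⟩
  have hsub := intervalIntegral.integral_deriv_smul_comp' (a := -b) (b := b) (f := sin)
    (f' := cos) (g := fun u : ℝ ↦ poissonIntegrand x u) (fun θ _ ↦ hasDerivAt_sin θ)
    continuous_cos.continuousOn ?_
  · rw [sin_neg] at hsub
    rw [← hsub]
    exact intervalIntegral.integral_congr
      fun θ hθ ↦ (poissonIntegrand_sin_mul_cos x (hcos θ hθ)).symm
  · rintro _ ⟨θ, hθ, rfl⟩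
    have hlt : |sin θ| < 1 := by
      rw [← sq_lt_one_iff_abs_lt_one]
      nlinarith [sin_sq_add_cos_sq θ, hcos θ hθ]
    refine ContinuousAt.continuousWithinAt ?_
    exact ContinuousAt.comp (f := Complex.ofReal)
      (differentiableAt_poissonIntegrand x (by rwa [Complex.ofReal_re])).continuousAt
      Complex.continuous_ofReal.continuousAt

lemma norm_integral_exp_sin_le {x : ℝ} (hx : 0 < x) :
    ‖∫ θ in (-(π / 2))..(π / 2), Complex.exp ((x * sin θ : ℝ) * Complex.I)‖ ≤
      2 * (2 ^ (-(1 / 2) : ℝ) * √(π / x)) := by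
  have hcont : Continuous fun θ : ℝ ↦ Complex.exp ((x * sin θ : ℝ) * Complex.I) := by fun_prop
  have hprim : Continuous fun b : ℝ ↦
      ∫ θ in (-b)..b, Complex.exp ((x * sin θ : ℝ) * Complex.I) := by
    have h := intervalIntegral.continuous_primitive
      (fun a b ↦ hcont.intervalIntegrable (μ := volume) a b) 0
    refine (h.sub (h.comp continuous_neg)).congr fun b ↦ ?_
    exact intervalIntegral.integral_interval_sub_left (hcont.intervalIntegrable _ _)
      (hcont.intervalIntegrable _ _)
  have hrhs : ContinuousAt (fun b : ℝ ↦ 2 * ((1 + sin b) ^ (-(1 / 2) : ℝ) * √(π / x)))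
      (π / 2) := by
    have hbase : ContinuousAt (fun b : ℝ ↦ 1 + sin b) (π / 2) := by fun_prop
    exact ((hbase.rpow_const (Or.inl (by norm_num))).mul_const _).const_mul _
  have hle := le_of_tendsto_of_tendsto
    (hprim.norm.continuousAt.mono_left (nhdsWithin_le_nhds (s := Set.Iio (π / 2))))
    (hrhs.mono_left nhdsWithin_le_nhds) ?_
  · beta_reduce at hle
    rwa [sin_pi_div_two, one_add_one_eq_two] at hle
  filter_upwards [Ioo_mem_nhdsLT pi_div_two_pos] with b ⟨hb, hb_lt⟩
  rw [integral_exp_sin_eq x hb hb_lt]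
  refine norm_integral_poissonIntegrand_le hx (sin_pos_of_pos_of_lt_pi hb (by linarith)) ?_
  rw [← sin_pi_div_two]
  exact sin_lt_sin_of_lt_of_le_pi_div_two (by linarith) le_rfl hb_lt

/-- The sharp decay bound `|J₀(x)| ≤ √(2 / (πx))`. -/
theorem abs_besselJ_zero_le {x : ℝ} (hx : 0 < x) : |besselJ 0 x| ≤ √(2 / (π * x)) := by
  have hper : Function.Periodic (fun θ : ℝ ↦ cos (x * sin θ)) π := by
    intro θ
    simp [sin_add_pi]
  have hshift := hper.intervalIntegral_add_eq 0 (-(π / 2))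
  rw [zero_add, show -(π / 2) + π = π / 2 by ring] at hshift
  have hre : ∫ θ in (-(π / 2))..(π / 2), cos (x * sin θ) =
      (∫ θ in (-(π / 2))..(π / 2), Complex.exp ((x * sin θ : ℝ) * Complex.I)).re := by
    rw [← Complex.reCLM_apply, ← ContinuousLinearMap.intervalIntegral_comp_comm]
    · simp only [Complex.reCLM_apply, Complex.exp_ofReal_mul_I_re]
    · exact Continuous.intervalIntegrable (by fun_prop) _ _
  have hJ : besselJ 0 x = 1 / π *
      (∫ θ in (-(π / 2))..(π / 2), Complex.exp ((x * sin θ : ℝ) * Complex.I)).re := by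
    rw [besselJ, ← hre, ← hshift]
    simp
  have hbound := (Complex.abs_re_le_norm _).trans (norm_integral_exp_sin_le hx)
  have hconst : 1 / π * (2 * (2 ^ (-(1 / 2) : ℝ) * √(π / x))) = √(2 / (π * x)) := by
    rw [rpow_neg (by norm_num), ← sqrt_eq_rpow]
    symm
    rw [sqrt_eq_iff_mul_self_eq (by positivity) (by positivity)]
    have h2 : √2 ^ 2 = 2 := sq_sqrt (by norm_num)
    have h3 : √(π / x) ^ 2 = π / x := sq_sqrt (by positivity)
    calc 2 / (π * x) = 4 * (π / x) / (π ^ 2 * 2) := by field_simp; norm_num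
      _ = 4 * √(π / x) ^ 2 / (π ^ 2 * √2 ^ 2) := by rw [h2, h3]
      _ = _ := by ring
  rw [hJ, abs_mul, abs_of_pos (by positivity), ← hconst]
  gcongr

/-- Corollary 2: upper bound of the UCA near-field beamforming gain in the distance
domain, `|J_0(ζ)| ≤ (2/(πR)) √(λ r₁ r₂ / |r₂ − r₁|)` for
`ζ = (2πR²/λ)|1/(4r₁) − 1/(4r₂)|`. -/
theorem gain_upper_bound (R lam r₁ r₂ : ℝ) (hR : 0 < R) (hlam : 0 < lam)
    (hr₁ : 0 < r₁) (hr₂ : 0 < r₂) (hne : r₁ ≠ r₂)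
    (ζ : ℝ) (hζ : ζ = (2 * π * R ^ 2 / lam) * |1 / (4 * r₁) - 1 / (4 * r₂)|) :
    |besselJ 0 ζ| ≤ (2 / (π * R)) * Real.sqrt (lam * r₁ * r₂ / |r₂ - r₁|) := by
  have hd : 0 < |r₂ - r₁| := abs_pos.mpr (sub_ne_zero.mpr hne.symm)
  have hζ' : ζ = π * R ^ 2 * |r₂ - r₁| / (2 * lam * r₁ * r₂) := by
    have : 1 / (4 * r₁) - 1 / (4 * r₂) = (r₂ - r₁) / (4 * r₁ * r₂) := by field_simp
    rw [hζ, this, abs_div, abs_of_pos (show 0 < 4 * r₁ * r₂ by positivity)]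
    field_simp
    norm_num
  have hpos : 0 < ζ := by rw [hζ']; positivity
  refine (abs_besselJ_zero_le hpos).trans_eq ?_
  have hsq : 2 / (π * ζ) = (2 / (π * R)) ^ 2 * (lam * r₁ * r₂ / |r₂ - r₁|) := by
    rw [hζ']
    field_simp
  rw [hsq, sqrt_mul (by positivity), sqrt_sq (by positivity)]
end

section
/- Let r₀, R, λ, η > 0 with r₀ < π*R^2/(2*η*λ). Define r₋ = π*R^2*r₀/(π*R^2 + 2*η*λ*r₀) and r₊ = π*R^2*r₀/(π*R^2 − 2*η*λ*r₀). Then: (i) the set {r : ℝ | r > 0 ∧ |1/(4*r₀) − 1/(4*r)| = η*λ/(2*π*R^2)} equals {r₋, r₊}; (ii) r₊ − r₋ = 4*π*η*λ*R^2*r₀^2/(π^2*R^4 − 4*η^2*λ^2*r₀^2); and (iii) for every r with r₋ ≤ r ≤ r₊, |1/(4*r₀) − 1/(4*r)| ≤ η*λ/(2*π*R^2). (Corollary 3, finite depth-of-focus case: the 3 dB depth-of-focus of the UCA near-field beam focused at distance r₀ equals 4πηλR²r₀²/(π²R⁴ − 4η²λ²r₀²).) -/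
open Real

lemma one_div_four_mul_sub_one_div_four_mul {s r : ℝ} (hs : s ≠ 0) (hr : r ≠ 0) :
    1 / (4 * s) - 1 / (4 * r) = (r - s) / (4 * s * r) := by
  field_simp

lemma one_div_four_mul_sub_le_iff {s r a b : ℝ} (hs : 0 < s) (hr : 0 < r) (ha : 0 < a)
    (hab : 0 < a - b * s) :
    1 / (4 * s) - 1 / (4 * r) ≤ b / (4 * a) ↔ r ≤ a * s / (a - b * s) := by
  rw [one_div_four_mul_sub_one_div_four_mul hs.ne' hr.ne', div_le_div_iff₀ (by positivity)
    (by positivity), le_div_iff₀ hab]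
  constructor <;> intro h <;> linarith

lemma one_div_four_mul_sub_eq_iff {s r a b : ℝ} (hs : 0 < s) (hr : 0 < r) (ha : 0 < a)
    (hab : 0 < a - b * s) :
    1 / (4 * s) - 1 / (4 * r) = b / (4 * a) ↔ r = a * s / (a - b * s) := by
  rw [one_div_four_mul_sub_one_div_four_mul hs.ne' hr.ne', div_eq_div_iff (by positivity)
    (by positivity), eq_div_iff hab.ne']
  constructor <;> intro h <;> linarith

lemma neg_le_one_div_four_mul_sub_iff {s r a b : ℝ} (hs : 0 < s) (hr : 0 < r) (ha : 0 < a)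
    (hab : 0 < a + b * s) :
    -(b / (4 * a)) ≤ 1 / (4 * s) - 1 / (4 * r) ↔ a * s / (a + b * s) ≤ r := by
  rw [one_div_four_mul_sub_one_div_four_mul hs.ne' hr.ne', ← neg_div,
    div_le_div_iff₀ (by positivity) (by positivity), div_le_iff₀ hab]
  constructor <;> intro h <;> linarith

/-- Corollary 3, finite depth-of-focus case: for `r₀ < πR²/(2ηλ)`, the 3 dB edges
`r₋ = πR²r₀/(πR² + 2ηλr₀)` and `r₊ = πR²r₀/(πR² − 2ηλr₀)` are exactly the positive
solutions of `|1/(4r₀) − 1/(4r)| = ηλ/(2πR²)`, their difference (the depth-of-focus)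
equals `4πηλR²r₀²/(π²R⁴ − 4η²λ²r₀²)`, and the gain condition holds on `[r₋, r₊]`. -/
theorem depth_of_focus_finite (r₀ R lam η : ℝ) (hr₀ : 0 < r₀) (hR : 0 < R)
    (hlam : 0 < lam) (hη : 0 < η) (hcond : r₀ < π * R ^ 2 / (2 * η * lam))
    (rm rp : ℝ)
    (hrm : rm = π * R ^ 2 * r₀ / (π * R ^ 2 + 2 * η * lam * r₀))
    (hrp : rp = π * R ^ 2 * r₀ / (π * R ^ 2 - 2 * η * lam * r₀)) :
    ({r : ℝ | r > 0 ∧ |1 / (4 * r₀) - 1 / (4 * r)| = η * lam / (2 * π * R ^ 2)}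
        = {rm, rp}) ∧
    (rp - rm = 4 * π * η * lam * R ^ 2 * r₀ ^ 2
        / (π ^ 2 * R ^ 4 - 4 * η ^ 2 * lam ^ 2 * r₀ ^ 2)) ∧
    (∀ r : ℝ, rm ≤ r → r ≤ rp →
        |1 / (4 * r₀) - 1 / (4 * r)| ≤ η * lam / (2 * π * R ^ 2)) := by
  have ha : 0 < π * R ^ 2 := by positivity
  have hadd : 0 < π * R ^ 2 + 2 * η * lam * r₀ := by positivity
  have hsub : 0 < π * R ^ 2 - 2 * η * lam * r₀ := by
    rw [lt_div_iff₀ (by positivity)] at hcond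
    linarith
  have hc : η * lam / (2 * π * R ^ 2) = 2 * η * lam / (4 * (π * R ^ 2)) := by
    field_simp
    norm_num
  have hrm_pos : 0 < rm := hrm ▸ by positivity
  have hrp_pos : 0 < rp := hrp ▸ by positivity
  refine ⟨?_, ?_, ?_⟩
  · ext r
    have key (hr : 0 < r) :
        |1 / (4 * r₀) - 1 / (4 * r)| = η * lam / (2 * π * R ^ 2) ↔ r = rm ∨ r = rp := by
      have hneg := one_div_four_mul_sub_eq_iff (b := -(2 * η * lam)) hr₀ hr ha (by linarith)
      rw [neg_mul, sub_neg_eq_add, neg_div] at hneg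
      rw [hc, abs_eq (by positivity), one_div_four_mul_sub_eq_iff hr₀ hr ha hsub, hneg, hrm, hrp,
        or_comm]
    simp only [Set.mem_ofPred_eq, Set.mem_insert_iff, Set.mem_singleton_iff, gt_iff_lt]
    refine ⟨fun h => (key h.1).1 h.2, fun h => ?_⟩
    have hr : 0 < r := by rcases h with rfl | rfl <;> assumption
    exact ⟨hr, (key hr).2 h⟩
  · rw [hrp, hrm, div_sub_div _ _ hsub.ne' hadd.ne']
    congr 1 <;> ring
  · intro r hr₁ hr₂
    have hr : 0 < r := hrm_pos.trans_le hr₁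
    rw [hc, abs_le, neg_le_one_div_four_mul_sub_iff hr₀ hr ha hadd,
      one_div_four_mul_sub_le_iff hr₀ hr ha hsub, ← hrm, ← hrp]
    exact ⟨hr₁, hr₂⟩
end

section
/- Let r₀, R, λ, η > 0 with r₀ ≥ π*R^2/(2*η*λ). Then the set {r : ℝ | r > 0 ∧ |1/(4*r₀) − 1/(4*r)| = η*λ/(2*π*R^2)} has exactly one element, namely r₋ = π*R^2*r₀/(π*R^2 + 2*η*λ*r₀), and moreover for every r ≥ r₋, |1/(4*r₀) − 1/(4*r)| ≤ η*λ/(2*π*R^2). (Corollary 3, infinite depth-of-focus case: when r₀ ≥ πR²/(2ηλ) there is only a one-sided 3 dB edge and the depth-of-focus is infinite.) -/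
open Real

/-- Corollary 3, infinite depth-of-focus case: for `r₀ ≥ πR²/(2ηλ)`, the equation
`|1/(4r₀) − 1/(4r)| = ηλ/(2πR²)` has exactly one positive solution
`r₋ = πR²r₀/(πR² + 2ηλr₀)`, and the gain condition holds for every `r ≥ r₋`. -/
theorem depth_of_focus_infinite (r₀ R lam η : ℝ) (hr₀ : 0 < r₀) (hR : 0 < R)
    (hlam : 0 < lam) (hη : 0 < η) (hcond : π * R ^ 2 / (2 * η * lam) ≤ r₀)
    (rm : ℝ)
    (hrm : rm = π * R ^ 2 * r₀ / (π * R ^ 2 + 2 * η * lam * r₀)) :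
    ({r : ℝ | r > 0 ∧ |1 / (4 * r₀) - 1 / (4 * r)| = η * lam / (2 * π * R ^ 2)}
        = {rm}) ∧
    (∀ r : ℝ, rm ≤ r →
        |1 / (4 * r₀) - 1 / (4 * r)| ≤ η * lam / (2 * π * R ^ 2)) := by
  have hrm_pos : 0 < rm := by rw [hrm]; positivity
  have hrm_inv : 1 / (4 * rm) = 1 / (4 * r₀) + η * lam / (2 * π * R ^ 2) := by
    rw [hrm]
    field_simp
    ring
  have hle : 1 / (4 * r₀) ≤ η * lam / (2 * π * R ^ 2) := by
    rw [div_le_iff₀ (by positivity)] at hcond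
    rw [div_le_div_iff₀ (by positivity) (by positivity)]
    linarith
  refine ⟨Set.ext fun r => ⟨?_, ?_⟩, fun r hr => ?_⟩
  · rintro ⟨hr, habs⟩
    have hinv : 0 < 1 / (4 * r) := by positivity
    have heq : 1 / (4 * r) = 1 / (4 * rm) := by
      rcases abs_choice (1 / (4 * r₀) - 1 / (4 * r)) with h | h <;> linarith
    rw [one_div, one_div, inv_inj] at heq
    exact Set.mem_singleton_iff.2 (by linarith)
  · rintro rfl
    have hc : 0 < η * lam / (2 * π * R ^ 2) := by positivity
    refine ⟨hrm_pos, ?_⟩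
    rw [hrm_inv, sub_add_cancel_left, abs_neg, abs_of_pos hc]
  · have hr_pos : 0 < r := hrm_pos.trans_le hr
    have hinv : 0 < 1 / (4 * r) := by positivity
    have hanti : 1 / (4 * r) ≤ 1 / (4 * rm) :=
      one_div_le_one_div_of_le (by positivity) (by linarith)
    exact abs_le.2 ⟨by linarith, by linarith⟩
end

section
/- Let R > 0, λ > 0, δ ∈ (0, 1), and let y₀ ∈ (0, 2] satisfy J_0(y₀) = 1 − δ. Define the effective Rayleigh distance r_ERD = π*R^2/(2*λ*y₀). Then for every r ≥ r_ERD, the far-field beamforming loss satisfies 1 − |J_0(π*R^2/(2*λ*r))| ≤ δ. (Lemma 3: beyond the effective Rayleigh distance r_ERD = πR²/(2λ J_0⁻¹(1−δ)), which is the same at every angle for a UCA, the loss from using far-field beam steering vectors never exceeds δ.) -/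
open Real MeasureTheory

/-- `J_0` is antitone on `[0, π]`. -/
theorem antitoneOn_besselJ_zero : AntitoneOn (besselJ 0) (Set.Icc 0 π) := by
  intro x hx y hy hxy
  unfold besselJ
  refine mul_le_mul_of_nonneg_left ?_ (by positivity)
  refine intervalIntegral.integral_mono_on pi_pos.le
    (Continuous.intervalIntegrable (by fun_prop) _ _)
    (Continuous.intervalIntegrable (by fun_prop) _ _) fun θ hθ => ?_
  have h0 : 0 ≤ Real.sin θ := sin_nonneg_of_mem_Icc hθ
  have h1 : Real.sin θ ≤ 1 := sin_le_one θ
  simp only [Int.cast_zero, zero_mul, sub_zero]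
  refine cos_le_cos_of_nonneg_of_le_pi (mul_nonneg hx.1 h0) ?_
    (mul_le_mul_of_nonneg_right hxy h0)
  exact (mul_le_of_le_one_right hy.1 h1).trans hy.2

/-- Lemma 3: beyond the effective Rayleigh distance `r_ERD = πR²/(2λ y₀)`, where
`y₀ ∈ (0, 2]` satisfies `J_0(y₀) = 1 − δ`, the far-field beamforming loss
`1 − |J_0(πR²/(2λr))|` never exceeds `δ`. -/
theorem effective_rayleigh_distance (R lam δ y₀ : ℝ) (hR : 0 < R) (hlam : 0 < lam)
    (hδ : δ ∈ Set.Ioo (0 : ℝ) 1) (hy₀ : y₀ ∈ Set.Ioc (0 : ℝ) 2)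
    (hJ : besselJ 0 y₀ = 1 - δ) :
    ∀ r : ℝ, π * R ^ 2 / (2 * lam * y₀) ≤ r →
      1 - |besselJ 0 (π * R ^ 2 / (2 * lam * r))| ≤ δ := by
  intro r hr
  obtain ⟨hy_pos, hy_le⟩ := hy₀
  have hr_pos : 0 < r := lt_of_lt_of_le (by positivity) hr
  have hx : π * R ^ 2 / (2 * lam * r) ≤ y₀ := by
    rw [div_le_iff₀ (by positivity)] at hr ⊢
    linarith
  have hy_pi : y₀ ≤ π := hy_le.trans two_le_pi
  have hle : besselJ 0 y₀ ≤ besselJ 0 (π * R ^ 2 / (2 * lam * r)) :=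
    antitoneOn_besselJ_zero ⟨by positivity, hx.trans hy_pi⟩ ⟨hy_pos.le, hy_pi⟩ hx
  have habs := le_abs_self (besselJ 0 (π * R ^ 2 / (2 * lam * r)))
  linarith
end

section
/- The Bessel function J_0 is strictly antitone on the interval [0, 2], and J_0(x) > 0 for every x ∈ [0, 2]. -/
open Real MeasureTheory

theorem besselJ_zero (x : ℝ) :
    besselJ 0 x = (1 / π) * ∫ θ in (0:ℝ)..π, cos (x * sin θ) := by
  simp [besselJ]

theorem strictAntiOn_besselJ_zero : StrictAntiOn (besselJ 0) (Set.Icc 0 π) := by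
  intro x hx y hy hxy
  rw [besselJ_zero, besselJ_zero]
  refine mul_lt_mul_of_pos_left ?_ (by positivity)
  refine intervalIntegral.integral_lt_integral_of_continuousOn_of_le_of_exists_lt pi_pos
    (by fun_prop) (by fun_prop) (fun θ hθ => ?_)
    ⟨π / 2, ⟨by positivity, by linarith [pi_pos]⟩, ?_⟩
  · have hs : 0 ≤ sin θ := sin_nonneg_of_nonneg_of_le_pi hθ.1.le hθ.2
    exact cos_le_cos_of_nonneg_of_le_pi (mul_nonneg hx.1 hs)
      ((mul_le_of_le_one_right hy.1 (sin_le_one θ)).trans hy.2)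
      (mul_le_mul_of_nonneg_right hxy.le hs)
  · simpa using cos_lt_cos_of_nonneg_of_le_pi hx.1 hy.2 hxy

theorem one_sub_two_mul_sq_add_le_cos_two_mul {s : ℝ} (hs : s ^ 2 ≤ 2) :
    1 - 2 * s ^ 2 + s ^ 4 / 2 ≤ cos (2 * s) := by
  rw [cos_two_mul]
  nlinarith [one_sub_sq_div_two_le_cos (x := s)]

theorem besselJ_zero_two_pos : 0 < besselJ 0 2 := by
  rw [besselJ_zero]
  refine mul_pos (by positivity) ?_
  have hsin_four : ∫ θ in (0:ℝ)..π, sin θ ^ 4 = 3 * π / 8 := by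
    rw [integral_sin_pow (n := 2), integral_sin_sq]
    simp
    ring
  have hpoly : ∫ θ in (0:ℝ)..π, (1 - 2 * sin θ ^ 2 + sin θ ^ 4 / 2) = 3 * π / 16 := by
    rw [intervalIntegral.integral_add
        (Continuous.intervalIntegrable (by fun_prop) _ _)
        (Continuous.intervalIntegrable (by fun_prop) _ _),
      intervalIntegral.integral_sub
        (Continuous.intervalIntegrable (by fun_prop) _ _)
        (Continuous.intervalIntegrable (by fun_prop) _ _),
      intervalIntegral.integral_const_mul, intervalIntegral.integral_div, hsin_four,
      integral_sin_sq]
    simp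
    ring
  calc (0:ℝ) < 3 * π / 16 := by positivity
    _ = ∫ θ in (0:ℝ)..π, (1 - 2 * sin θ ^ 2 + sin θ ^ 4 / 2) := hpoly.symm
    _ ≤ ∫ θ in (0:ℝ)..π, cos (2 * sin θ) :=
      intervalIntegral.integral_mono_on pi_pos.le
        (Continuous.intervalIntegrable (by fun_prop) _ _)
        (Continuous.intervalIntegrable (by fun_prop) _ _)
        fun θ _ => one_sub_two_mul_sq_add_le_cos_two_mul
          ((sin_sq_le_one θ).trans one_le_two)

/-- `J_0` is strictly antitone on `[0, 2]` and positive there. -/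
theorem besselJ_zero_strictAntiOn_pos :
    StrictAntiOn (fun x : ℝ => besselJ 0 x) (Set.Icc (0 : ℝ) 2) ∧
    ∀ x ∈ Set.Icc (0 : ℝ) 2, 0 < besselJ 0 x := by
  have hanti : StrictAntiOn (besselJ 0) (Set.Icc (0 : ℝ) 2) :=
    strictAntiOn_besselJ_zero.mono (Set.Icc_subset_Icc_right two_le_pi)
  exact ⟨hanti, fun x hx => besselJ_zero_two_pos.trans_le
    (hanti.antitoneOn hx (Set.right_mem_Icc.2 zero_le_two) hx.2)⟩
end

section
/- Let r > 0 and R > 0 with 5*R ≤ r, and let c ∈ ℝ with |c| ≤ 1. Then |Real.sqrt (r^2 + R^2 − 2*r*R*c) − (r − R*c + (R^2/(2*r))*(1 − c^2))| ≤ 5*R^3/r^2. (This rigorously bounds the second-order Taylor approximation of the propagation distance r⁽ⁿ⁾ = √(r² + R² − 2rR cos(φ − ψₙ)) ≈ r − R cos(φ − ψₙ) + (R²/(2r))(1 − cos²(φ − ψₙ)) used throughout the near-field analysis of the uniform circular array, with c = cos(φ − ψₙ).) -/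
open Real

/-- Rigorous bound on the second-order Taylor approximation of the propagation
distance: for `r ≥ 5R > 0` and `|c| ≤ 1`,
`|√(r² + R² − 2rRc) − (r − Rc + (R²/(2r))(1 − c²))| ≤ 5R³/r²`. -/
theorem propagation_distance_taylor (r R c : ℝ) (hr : 0 < r) (hR : 0 < R)
    (h5 : 5 * R ≤ r) (hc : |c| ≤ 1) :
    |Real.sqrt (r ^ 2 + R ^ 2 - 2 * r * R * c)
        - (r - R * c + (R ^ 2 / (2 * r)) * (1 - c ^ 2))| ≤ 5 * R ^ 3 / r ^ 2 := by
  obtain ⟨hc₁, hc₂⟩ := abs_le.mp hc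
  have hs₀ : 0 ≤ 1 - c ^ 2 := by nlinarith
  have hs₁ : 1 - c ^ 2 ≤ 1 := by nlinarith [sq_nonneg c]
  set s := 1 - c ^ 2 with hs
  set T := r - R * c + R ^ 2 / (2 * r) * s with hT
  set S := √(r ^ 2 + R ^ 2 - 2 * r * R * c) with hS
  have hS₀ : 0 ≤ S := Real.sqrt_nonneg _
  have hSsq : S ^ 2 = r ^ 2 + R ^ 2 - 2 * r * R * c :=
    Real.sq_sqrt (by nlinarith [mul_pos hr hR, sq_nonneg (r - R)])
  have hT₀ : 4 / 5 * r ≤ T := by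
    have : 0 ≤ R ^ 2 / (2 * r) * s := by positivity
    nlinarith
  have hdiff : S ^ 2 - T ^ 2 = R ^ 3 / r * (c * s - R / r * s ^ 2 / 4) := by
    rw [hSsq, hT, hs]
    field_simp
    ring
  have hx₀ : 0 ≤ R / r := by positivity
  have hx₁ : R / r ≤ 1 / 5 := by
    rw [div_le_iff₀ hr]
    linarith
  have hcoeff : |c * s - R / r * s ^ 2 / 4| ≤ 2 := by
    have hcs : |c * s| ≤ 1 := by
      rw [abs_mul, abs_of_nonneg hs₀]
      exact mul_le_one₀ hc hs₀ hs₁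
    have hxs : R / r * s ^ 2 ≤ 1 :=
      mul_le_one₀ (by linarith) (by positivity) (pow_le_one₀ hs₀ hs₁)
    have hxs₀ : 0 ≤ R / r * s ^ 2 := by positivity
    obtain ⟨h₁, h₂⟩ := abs_le.mp hcs
    exact abs_le.mpr ⟨by linarith, by linarith⟩
  have hTpos : 0 < T := by linarith
  have hprod : |S - T| * (S + T) ≤ R ^ 3 / r * 2 := by
    rw [← abs_of_nonneg (by positivity : 0 ≤ S + T), ← abs_mul,
      show (S - T) * (S + T) = S ^ 2 - T ^ 2 by ring, hdiff, abs_mul,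
      abs_of_nonneg (by positivity : 0 ≤ R ^ 3 / r)]
    gcongr
  have hmul : |S - T| * (4 / 5 * r) ≤ R ^ 3 / r * 2 :=
    (mul_le_mul_of_nonneg_left (by linarith) (abs_nonneg _)).trans hprod
  calc |S - T| ≤ R ^ 3 / r * 2 / (4 / 5 * r) := (le_div_iff₀ (by positivity)).mpr hmul
    _ = 5 / 2 * (R ^ 3 / r ^ 2) := by field_simp; norm_num
    _ ≤ 5 * R ^ 3 / r ^ 2 := by
      rw [mul_div_assoc]
      gcongr
      norm_num
end
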